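/- Let M be a cleaned-up MDP with target sets F_1,…,F_k ⊆ V, F = ∪_i F_i, every state of F absorbing, let α be an initial distribution supported on V∖F (with V∖F ≠ ∅), and let r ∈ (0,1]^k. Then the following are equivalent: (1) there is a (possibly randomized) memoryless strategy σ with Pr^σ_α(◇F_i) ≥ r_i for all i; (2) there is a feasible solution y' of the multi-objective LP associated with (M, α, F_1,…,F_k) such that Σ_{v ∈ F_i} y'_v ≥ r_i for all i; (3) there is an arbitrary (history-dependent, randomized) strategy σ with Pr^σ_α(◇F_i) ≥ r_i for all i. -/

import Mathlib

open scoped BigOperators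
open MeasureTheory

/-- A finite-state Markov decision process: a finite set of states `V`, a finite
action alphabet `A`, a nonempty set of enabled actions at each state, and for each
state and enabled action a probability distribution on next states. -/
structure MDP (V A : Type) [Fintype V] [Fintype A] where
  enabled : V → Finset A
  enabled_nonempty : ∀ v, (enabled v).Nonempty
  p : V → A → V → ℝ
  p_nonneg : ∀ v a v', 0 ≤ p v a v'
  p_sum : ∀ v, ∀ a ∈ enabled v, ∑ v', p v a v' = 1

namespace MDP

variable {V A : Type} [Fintype V] [Fintype A]

/-- A (history-dependent, randomized) strategy: given the list of past
(state, action) pairs (most recent first) and the current state, a probability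
distribution on actions, supported on the enabled actions. -/
structure Strategy (M : MDP V A) where
  act : List (V × A) → V → A → ℝ
  act_nonneg : ∀ h v a, 0 ≤ act h v a
  act_support : ∀ h v a, a ∉ M.enabled v → act h v a = 0
  act_sum : ∀ h v, ∑ a, act h v a = 1

/-- A strategy is memoryless (stationary) if it depends only on the current state. -/
def Strategy.Memoryless {M : MDP V A} (σ : M.Strategy) : Prop :=
  ∀ h h' v, σ.act h v = σ.act h' v

/-- A strategy is pure (deterministic) if it always plays a single action with
probability 1. -/
def Strategy.Pure {M : MDP V A} (σ : M.Strategy) : Prop :=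
  ∀ h v, ∃ a, σ.act h v a = 1

/-- `α` is a probability distribution on `V`. -/
def IsDist (α : V → ℝ) : Prop :=
  (∀ v, 0 ≤ α v) ∧ ∑ v, α v = 1

/-- The point (Dirac) distribution at `u`. -/
def diracD [DecidableEq V] (u : V) : V → ℝ := fun v => if v = u then 1 else 0

/-- The `m`-th binary digit of `x`. -/
noncomputable def bit (m : ℕ) (x : ℝ) : ℝ :=
  if ⌊x * 2 ^ (m + 1)⌋ % 2 = 1 then 1 else 0

/-- Extracts from a single seed `x ∈ [0,1]` a sequence of independent uniform
`[0,1]` samples, by splitting the binary digits of `x`. -/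
noncomputable def unif (k : ℕ) (x : ℝ) : ℝ :=
  ∑' n : ℕ, bit (Nat.pair k n) x / 2 ^ (n + 1)

/-- Inverse-CDF sampling from a distribution `q` on a finite type, using the
uniform sample `u`. -/
noncomputable def sample {S : Type} [Fintype S] [Nonempty S] (q : S → ℝ) (u : ℝ) : S :=
  let e := Fintype.equivFin S
  if h : (Finset.univ.filter fun i => u < ∑ j ∈ Finset.Iic i, q (e.symm j)).Nonempty then
    e.symm ((Finset.univ.filter fun i => u < ∑ j ∈ Finset.Iic i, q (e.symm j)).min' h)
  else Classical.arbitrary S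

variable [Nonempty V] [Nonempty A]

/-- The random run of `M` under strategy `σ` from initial distribution `α`, driven by
the random seed `x`: at time `n` it returns the list of past (state, action) pairs
(most recent first) together with the current state and the action chosen there. -/
noncomputable def run (M : MDP V A) (σ : M.Strategy) (α : V → ℝ) (x : ℝ) :
    ℕ → List (V × A) × (V × A)
  | 0 =>
      let s := sample α (unif 0 x)
      ([], (s, sample (σ.act [] s) (unif 1 x)))
  | n + 1 =>
      let r := run M σ α x n
      let s' := sample (M.p r.2.1 r.2.2) (unif (2 * n + 2) x)
      (r.2 :: r.1, (s', sample (σ.act (r.2 :: r.1) s') (unif (2 * n + 3) x)))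

/-- The state at time `n` of the run driven by seed `x`. -/
noncomputable def stateAt (M : MDP V A) (σ : M.Strategy) (α : V → ℝ) (x : ℝ) (n : ℕ) : V :=
  (M.run σ α x n).2.1

/-- The probability, under strategy `σ` from initial distribution `α`, that the
infinite trajectory of states belongs to the event `E`. -/
noncomputable def PrEvent (M : MDP V A) (σ : M.Strategy) (α : V → ℝ) (E : Set (ℕ → V)) : ℝ :=
  (volume {x : ℝ | x ∈ Set.Icc (0 : ℝ) 1 ∧ M.stateAt σ α x ∈ E}).toReal

/-- The probability of eventually visiting the set `F` (the event `◇F`). -/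
noncomputable def PrReach (M : MDP V A) (σ : M.Strategy) (α : V → ℝ) (F : Set V) : ℝ :=
  M.PrEvent σ α {w | ∃ n, w n ∈ F}

/-- A state is absorbing if it has a single enabled action, which loops on it with
probability 1. -/
def Absorbing (M : MDP V A) (v : V) : Prop :=
  ∃ a, M.enabled v = {a} ∧ M.p v a v = 1

/-- One positive-probability step of the underlying graph of the MDP. -/
def Step (M : MDP V A) (v v' : V) : Prop :=
  ∃ a ∈ M.enabled v, 0 < M.p v a v'

/-- The MDP is cleaned-up w.r.t. `F`: from every state there is a path of
positive-probability transitions reaching `F`. -/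
def CleanedUp (M : MDP V A) (F : Set V) : Prop :=
  ∀ v, ∃ w ∈ F, Relation.ReflTransGen M.Step v w

end MDP

namespace MDP

variable {V A : Type} [Fintype V] [Fintype A]

/-- Feasibility for the multi-objective LP associated with `(M, α, F)`:
`y` are the variables `y_{(v,γ)}` (for `v ∉ F`), `yF` the variables `y_v` (for `v ∈ F`). -/
def LPFeasible [DecidableEq V] (M : MDP V A) (α : V → ℝ) (F : Finset V)
    (y : V → A → ℝ) (yF : V → ℝ) : Prop :=
  (∀ v ∉ F, (∑ a ∈ M.enabled v, y v a) -
      (∑ v' ∈ Fᶜ, ∑ a' ∈ M.enabled v', M.p v' a' v * y v' a') = α v) ∧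
  (∀ v ∈ F, yF v - (∑ v' ∈ Fᶜ, ∑ a' ∈ M.enabled v', M.p v' a' v * y v' a') = 0) ∧
  (∀ v ∈ F, 0 ≤ yF v) ∧
  (∀ v ∉ F, ∀ a ∈ M.enabled v, 0 ≤ y v a)

/-- The substochastic matrix `P^σ` on `V ∖ F` induced by a memoryless strategy `σ`. -/
noncomputable def Pmat [DecidableEq V] (M : MDP V A) (σ : M.Strategy) (F : Finset V) :
    Matrix {v : V // v ∉ F} {v : V // v ∉ F} ℝ :=
  Matrix.of fun v v' => ∑ a ∈ M.enabled v.1, σ.act [] v.1 a * M.p v.1 a v'.1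

end MDP

namespace MDP

/-- The uniform probability measure on the seed space `[0,1]`. -/
noncomputable def seedMeasure : Measure ℝ := volume.restrict (Set.Icc 0 1)

instance : IsProbabilityMeasure seedMeasure := ⟨by simp [seedMeasure]⟩

/-- The law of a fair coin with values in `{0, 1}`. -/
noncomputable def coin : Measure ℝ :=
  (2⁻¹ : ENNReal) • Measure.dirac 0 + (2⁻¹ : ENNReal) • Measure.dirac 1

instance : IsProbabilityMeasure coin := ⟨by simp [coin, ENNReal.inv_two_add_inv_two]⟩

lemma measurable_bit (m : ℕ) : Measurable (bit m) := by
  unfold bit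
  refine Measurable.ite ?_ measurable_const measurable_const
  have h : Measurable fun x : ℝ => ⌊x * 2 ^ (m + 1)⌋ % 2 :=
    (measurable_of_countable fun z : ℤ => z % 2).comp
      (Int.measurable_floor.comp (measurable_id.mul_const _))
  exact h (measurableSet_singleton 1)

lemma bit_succ (m : ℕ) (x : ℝ) : bit (m + 1) x = bit m (2 * x) := by
  unfold bit
  rw [show x * 2 ^ (m + 1 + 1) = 2 * x * 2 ^ (m + 1) by ring]

lemma bit_sub_one (m : ℕ) (x : ℝ) : bit m (x - 1) = bit m x := by
  unfold bit
  have : (x - 1) * 2 ^ (m + 1) = x * 2 ^ (m + 1) - ((2 ^ (m + 1) : ℤ) : ℝ) := by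
    push_cast; ring
  rw [this, Int.floor_sub_intCast, pow_succ]
  congr 2
  omega

lemma bit_zero_of_lt {x : ℝ} (h0 : 0 ≤ x) (h1 : x < 1 / 2) : bit 0 x = 0 := by
  have : ⌊x * 2 ^ (0 + 1)⌋ = 0 := by
    rw [Int.floor_eq_iff]; constructor <;> push_cast <;> linarith
  unfold bit
  rw [this]
  norm_num

lemma bit_zero_of_ge {x : ℝ} (h0 : 1 / 2 ≤ x) (h1 : x < 1) : bit 0 x = 1 := by
  have : ⌊x * 2 ^ (0 + 1)⌋ = 1 := by
    rw [Int.floor_eq_iff]; constructor <;> push_cast <;> linarith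
  unfold bit
  rw [this]
  norm_num

/-- The first `n` binary digits of a uniform point of `[0,1)` are independent fair coins. -/
lemma volume_bit_box (n : ℕ) (t : ℕ → Set ℝ) :
    volume {x : ℝ | x ∈ Set.Ico (0 : ℝ) 1 ∧ ∀ i < n, bit i x ∈ t i} =
      ∏ i ∈ Finset.range n, coin (t i) := by
  induction n generalizing t with
  | zero =>
    have : {x : ℝ | x ∈ Set.Ico (0 : ℝ) 1 ∧ ∀ i < 0, bit i x ∈ t i} = Set.Ico 0 1 := by
      ext x; simp
    rw [this]
    simp
  | succ n ih =>
    classical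
    set B : Set ℝ := {x : ℝ | x ∈ Set.Ico (0 : ℝ) 1 ∧ ∀ i < n, bit i x ∈ t (i + 1)} with hB
    have hB' : volume B = ∏ i ∈ Finset.range n, coin (t (i + 1)) := ih fun i => t (i + 1)
    set L : Set ℝ := {x : ℝ | x ∈ Set.Ico (0 : ℝ) 1 ∧ ∀ i < n + 1, bit i x ∈ t i} with hL
    have split : ∀ x, (∀ i < n + 1, bit i x ∈ t i) ↔
        bit 0 x ∈ t 0 ∧ ∀ i < n, bit i (2 * x) ∈ t (i + 1) := by
      intro x
      constructor
      · intro h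
        exact ⟨h 0 (by omega), fun i hi => by rw [← bit_succ]; exact h _ (by omega)⟩
      · rintro ⟨h0, h⟩ i hi
        rcases i with _ | i
        · exact h0
        · rw [bit_succ]; exact h i (by omega)
    have half : volume ((fun x : ℝ => 2 * x) ⁻¹' B) = 2⁻¹ * volume B := by
      rw [Real.volume_preimage_mul_left (by norm_num)]
      congr 1
      rw [abs_of_pos (by norm_num), ENNReal.ofReal_inv_of_pos (by norm_num)]
      norm_num
    have half' : volume ((fun x : ℝ => x + (-1 / 2)) ⁻¹' ((fun x : ℝ => 2 * x) ⁻¹' B)) =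
        2⁻¹ * volume B := by
      rw [measure_preimage_add_right, half]
    have lower : L ∩ Set.Iio (1 / 2) = if (0 : ℝ) ∈ t 0 then (fun x : ℝ => 2 * x) ⁻¹' B else ∅ := by
      ext x
      simp only [hL, Set.mem_inter_iff, Set.mem_ofPred_eq, split, Set.mem_Ico, Set.mem_Iio]
      by_cases hx : 0 ≤ x ∧ x < 1 / 2
      · rw [bit_zero_of_lt hx.1 hx.2]
        split_ifs with h
        · simp only [Set.mem_preimage, hB, Set.mem_ofPred_eq, Set.mem_Ico]
          constructor
          · rintro ⟨⟨-, -, h⟩, -⟩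
            exact ⟨⟨by linarith, by linarith⟩, h⟩
          · rintro ⟨-, h'⟩
            exact ⟨⟨⟨hx.1, by linarith⟩, h, h'⟩, hx.2⟩
        · simp [h]
      · constructor
        · rintro ⟨⟨h1, -⟩, h2⟩
          exact absurd ⟨h1.1, h2⟩ hx
        · intro h
          split_ifs at h
          · simp only [Set.mem_preimage, hB, Set.mem_ofPred_eq, Set.mem_Ico] at h
            exact absurd ⟨by linarith, by linarith⟩ hx
          · exact h.elim
    have upper : L \ Set.Iio (1 / 2) = if (1 : ℝ) ∈ t 0 then
        (fun x : ℝ => x + (-1 / 2)) ⁻¹' ((fun x : ℝ => 2 * x) ⁻¹' B) else ∅ := by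
      ext x
      have e : 2 * (x + (-1 / 2)) = 2 * x - 1 := by ring
      simp only [hL, Set.mem_sdiff, Set.mem_ofPred_eq, split, Set.mem_Ico, Set.mem_Iio, not_lt]
      by_cases hx : 1 / 2 ≤ x ∧ x < 1
      · rw [bit_zero_of_ge hx.1 hx.2]
        split_ifs with h
        · simp only [Set.mem_preimage, hB, Set.mem_ofPred_eq, Set.mem_Ico, e, bit_sub_one]
          constructor
          · rintro ⟨⟨-, -, h⟩, -⟩
            exact ⟨⟨by linarith, by linarith⟩, h⟩
          · rintro ⟨-, h'⟩
            exact ⟨⟨⟨by linarith, hx.2⟩, h, h'⟩, hx.1⟩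
        · simp [h]
      · constructor
        · rintro ⟨⟨h1, -⟩, h2⟩
          exact absurd ⟨h2, h1.2⟩ hx
        · intro h
          split_ifs at h
          · simp only [Set.mem_preimage, hB, Set.mem_ofPred_eq, Set.mem_Ico] at h
            exact absurd ⟨by linarith, by linarith⟩ hx
          · exact h.elim
    rw [← measure_inter_add_sdiff L (measurableSet_Iio (a := (1 / 2 : ℝ))), lower, upper,
      Finset.prod_range_succ', ← hB']
    have hc : coin (t 0) =
        (if (0 : ℝ) ∈ t 0 then 2⁻¹ else 0) + (if (1 : ℝ) ∈ t 0 then 2⁻¹ else 0) := by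
      simp [coin, Set.indicator_apply]
    rw [hc, mul_add]
    congr 1
    · split_ifs
      · rw [half, mul_comm]
      · simp
    · split_ifs
      · rw [half', mul_comm]
      · simp

lemma seedMeasure_eq : seedMeasure = volume.restrict (Set.Ico 0 1) :=
  Measure.restrict_congr_set Ico_ae_eq_Icc.symm

lemma map_bit :
    seedMeasure.map (fun x m => bit m x) = Measure.infinitePi fun _ : ℕ => coin := by
  classical
  refine Measure.eq_infinitePi _ fun s t ht => ?_
  rw [Measure.map_apply (measurable_pi_lambda _ measurable_bit)
    (.pi s.countable_toSet fun _ _ => ht _), seedMeasure_eq,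
    Measure.restrict_apply' measurableSet_Ico]
  obtain ⟨n, hn⟩ := s.exists_nat_subset_range
  have key := volume_bit_box n fun i => if i ∈ s then t i else Set.univ
  have hset : ((fun x m => bit m x) ⁻¹' (s : Set ℕ).pi t) ∩ Set.Ico 0 1 =
      {x : ℝ | x ∈ Set.Ico (0 : ℝ) 1 ∧ ∀ i < n, bit i x ∈ if i ∈ s then t i else Set.univ} := by
    ext x
    simp only [Set.mem_inter_iff, Set.mem_preimage, Set.mem_pi, SetLike.mem_coe, Set.mem_ofPred_eq]
    rw [and_comm]
    refine and_congr_right fun _ => ⟨fun h i _ => ?_, fun h i hi => ?_⟩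
    · split_ifs with his
      · exact h i his
      · trivial
    · simpa [hi] using h i (Finset.mem_range.1 (hn hi))
  rw [hset, key, ← Finset.prod_subset hn]
  · exact Finset.prod_congr rfl fun i hi => by simp [hi]
  · intro i _ hi
    simp [hi]

lemma sum_bit (x : ℝ) (h0 : 0 ≤ x) (h1 : x < 1) (n : ℕ) :
    ∑ i ∈ Finset.range n, bit i x / 2 ^ (i + 1) = ⌊x * 2 ^ n⌋ / 2 ^ n := by
  induction n with
  | zero =>
    have : ⌊x⌋ = 0 := Int.floor_eq_zero_iff.2 ⟨h0, h1⟩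
    simp [this]
  | succ n ih =>
    rw [Finset.sum_range_succ, ih]
    have hfl : ⌊x * 2 ^ n⌋ = ⌊x * 2 ^ (n + 1)⌋ / 2 := by
      have := Int.floor_div_natCast (x * 2 ^ (n + 1)) 2
      rw [← Nat.cast_ofNat (R := ℤ), ← this]
      congr 1
      push_cast
      rw [pow_succ]
      ring
    have hb : bit n x = ((⌊x * 2 ^ (n + 1)⌋ % 2 : ℤ) : ℝ) := by
      unfold bit
      rcases Int.emod_two_eq_zero_or_one ⌊x * 2 ^ (n + 1)⌋ with h | h <;> simp [h]
    have hdm : (⌊x * 2 ^ (n + 1)⌋ : ℝ) = 2 * ⌊x * 2 ^ n⌋ + bit n x := by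
      rw [hb, hfl]
      exact_mod_cast (Int.mul_ediv_add_emod _ _).symm
    rw [hdm, pow_succ]
    field_simp

lemma bit_nonneg (n : ℕ) (x : ℝ) : 0 ≤ bit n x := by
  unfold bit; split_ifs <;> norm_num

lemma bit_eq (n : ℕ) (x : ℝ) : bit n x = 0 ∨ bit n x = 1 := by
  unfold bit; split_ifs <;> simp

/-- The binary expansion of a point of `[0,1)` sums to that point. -/
lemma tsum_bit {x : ℝ} (h0 : 0 ≤ x) (h1 : x < 1) : ∑' n, bit n x / 2 ^ (n + 1) = x := by
  refine HasSum.tsum_eq ?_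
  rw [hasSum_iff_tendsto_nat_of_nonneg fun n => div_nonneg (bit_nonneg n x) (by positivity)]
  simp_rw [sum_bit x h0 h1]
  have lim : Filter.Tendsto (fun n : ℕ => x - (1 / 2 : ℝ) ^ n) Filter.atTop (nhds x) := by
    simpa using tendsto_const_nhds.sub
      (tendsto_pow_atTop_nhds_zero_of_lt_one (r := (1 / 2 : ℝ)) (by norm_num) (by norm_num))
  refine tendsto_of_tendsto_of_tendsto_of_le_of_le lim tendsto_const_nhds (fun n => ?_) fun n => ?_
  · have := (Int.sub_one_lt_floor (x * 2 ^ n)).le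
    simp only [one_div, inv_pow]
    rw [le_div_iff₀ (by positivity), sub_mul, inv_mul_cancel₀ (by positivity)]
    exact this
  · simp only
    rw [div_le_iff₀ (by positivity)]
    exact Int.floor_le _

/-- The number with prescribed binary digits. -/
noncomputable def ofBits (b : ℕ → ℝ) : ℝ := ∑' n, (if b n = 1 then 1 else 0) / 2 ^ (n + 1)

lemma ofBits_bit (f : ℕ → ℕ) (x : ℝ) :
    ofBits (fun n => bit (f n) x) = ∑' n, bit (f n) x / 2 ^ (n + 1) := by
  refine tsum_congr fun n => ?_
  rcases bit_eq (f n) x with h | h <;> simp [h]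

lemma summable_digits (b : ℕ → ℝ) :
    Summable fun n : ℕ => (if b n = 1 then (1 : ℝ) else 0) / 2 ^ (n + 1) := by
  refine Summable.of_nonneg_of_le (fun n => by split_ifs <;> positivity) (fun n => ?_)
    (summable_geometric_two' 1)
  rw [pow_succ', ← div_div]
  split_ifs
  · simp
  · rw [zero_div, zero_div]; positivity

lemma measurable_ofBits : Measurable ofBits := by
  refine measurable_of_tendsto_metrizable (f := fun N b =>
    ∑ n ∈ Finset.range N, (if b n = 1 then (1 : ℝ) else 0) / 2 ^ (n + 1)) (fun N => ?_) ?_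
  · refine Finset.measurable_sum _ fun n _ => Measurable.div_const ?_ _
    exact Measurable.ite (measurable_pi_apply n (measurableSet_singleton 1)) measurable_const
      measurable_const
  · exact tendsto_pi_nhds.2 fun b => (summable_digits b).hasSum.tendsto_sum_nat

lemma map_ofBits : (Measure.infinitePi fun _ : ℕ => coin).map ofBits = seedMeasure := by
  rw [← map_bit, Measure.map_map measurable_ofBits (measurable_pi_lambda _ measurable_bit)]
  have : ofBits ∘ (fun x m => bit m x) =ᵐ[seedMeasure] id := by
    rw [seedMeasure_eq]
    filter_upwards [ae_restrict_mem measurableSet_Ico] with x hx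
    simp only [Function.comp, id]
    rw [ofBits_bit (fun n => n), tsum_bit hx.1 hx.2]
  rw [Measure.map_congr this, Measure.map_id]

lemma unif_eq (k : ℕ) (x : ℝ) : unif k x = ofBits fun n => bit (Nat.pair k n) x :=
  (ofBits_bit _ x).symm

lemma measurable_unif (k : ℕ) : Measurable (unif k) := by
  rw [funext (unif_eq k)]
  exact measurable_ofBits.comp (measurable_pi_lambda _ fun n => measurable_bit _)

lemma unif_nonneg (k : ℕ) (x : ℝ) : 0 ≤ unif k x :=
  tsum_nonneg fun _ => div_nonneg (bit_nonneg _ _) (by positivity)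

/-- The samples extracted from the seed are jointly independent and uniform. -/
lemma map_unif :
    seedMeasure.map (fun x k => unif k x) = Measure.infinitePi fun _ : ℕ => seedMeasure := by
  have h1 : seedMeasure.map (fun x (q : ℕ × ℕ) => bit (Nat.pair q.1 q.2) x) =
      Measure.infinitePi fun _ : ℕ × ℕ => coin := by
    rw [← Measure.map_infinitePi_infinitePi_of_inj (P := fun _ : ℕ => coin)
      (f := fun q : ℕ × ℕ => Nat.pair q.1 q.2) Nat.pairEquiv.injective, ← map_bit,
      Measure.map_map (by fun_prop) (measurable_pi_lambda _ measurable_bit)]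
    rfl
  have h2 := Measure.infinitePi_map_curry fun _ _ : ℕ => coin
  have h3 := Measure.infinitePi_map_pi (fun _ : ℕ => Measure.infinitePi fun _ : ℕ => coin)
    (f := fun _ => ofBits) fun _ => measurable_ofBits
  simp only [map_ofBits] at h3
  rw [← h3, ← h2, ← h1, Measure.map_map (by fun_prop)
    (measurable_pi_lambda _ fun q => measurable_bit _),
    Measure.map_map (g := fun (b : ℕ → ℕ → ℝ) k => ofBits (b k))
    (measurable_pi_lambda _ fun k => measurable_ofBits.comp (measurable_pi_apply k))
    ((MeasurableEquiv.measurable _).comp (measurable_pi_lambda _ fun q => measurable_bit _))]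
  congr 1
  funext x k
  exact unif_eq k x

lemma map_unif_apply (k : ℕ) : seedMeasure.map (unif k) = seedMeasure := by
  have h := Measure.infinitePi_map_eval (fun _ : ℕ => seedMeasure) k
  rw [← map_unif, Measure.map_map (measurable_pi_apply k)
    (measurable_pi_lambda _ measurable_unif)] at h
  exact h

lemma iIndepFun_unif : ProbabilityTheory.iIndepFun unif seedMeasure := by
  rw [ProbabilityTheory.iIndepFun_iff_map_fun_eq_infinitePi_map measurable_unif, map_unif]
  simp only [map_unif_apply]

end MDP

namespace MDP

open ProbabilityTheory Filter

section Sampling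

variable {S : Type} [Fintype S] [Nonempty S]

lemma sample_eq_iff {q : S → ℝ} (hq : IsDist q) {u : ℝ} (h0 : 0 ≤ u) (h1 : u < 1) (s : S) :
    sample q u = s ↔
      ∑ j ∈ Finset.Iio (Fintype.equivFin S s), q ((Fintype.equivFin S).symm j) ≤ u ∧
        u < ∑ j ∈ Finset.Iic (Fintype.equivFin S s), q ((Fintype.equivFin S).symm j) := by
  set e := Fintype.equivFin S with he
  set C : Fin (Fintype.card S) → ℝ := fun i => ∑ j ∈ Finset.Iic i, q (e.symm j) with hC
  have hmono : Monotone C := fun i j hij =>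
    Finset.sum_le_sum_of_subset_of_nonneg (Finset.Iic_subset_Iic.2 hij) fun _ _ _ => hq.1 _
  have hne : (Finset.univ.filter fun i => u < C i).Nonempty := by
    have : 0 < Fintype.card S := Fintype.card_pos
    let top : Fin (Fintype.card S) := ⟨Fintype.card S - 1, by omega⟩
    refine ⟨top, by
      simp only [Finset.mem_filter, Finset.mem_univ, true_and]
      have huniv : Finset.Iic top = Finset.univ := by
        ext i
        simp only [Finset.mem_Iic, Finset.mem_univ, iff_true, Fin.le_def, top]
        omega
      have : C top = 1 := by
        simp only [hC, huniv]
        rw [← hq.2]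
        exact Equiv.sum_comp e.symm q
      rw [this]
      exact h1⟩
  have hs : sample q u = e.symm ((Finset.univ.filter fun i => u < C i).min' hne) := by
    unfold sample
    exact dif_pos hne
  have hpred : ∀ i, ∑ j ∈ Finset.Iio i, q (e.symm j) ≤ u ↔ ∀ j < i, C j ≤ u := by
    intro i
    constructor
    · intro h j hj
      refine le_trans (Finset.sum_le_sum_of_subset_of_nonneg (fun l hl => ?_) fun _ _ _ => hq.1 _) h
      exact Finset.mem_Iio.2 (lt_of_le_of_lt (Finset.mem_Iic.1 hl) hj)
    · intro h
      rcases Nat.eq_zero_or_pos i.1 with hi | hi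
      · have : Finset.Iio i = ∅ := by
          ext j
          simp only [Finset.mem_Iio, Fin.lt_def, Finset.notMem_empty, iff_false]
          omega
        simpa [this] using h0
      · have hlt : (⟨i.1 - 1, by omega⟩ : Fin (Fintype.card S)) < i := by
          simp only [Fin.lt_def]; omega
        have : Finset.Iio i = Finset.Iic (⟨i.1 - 1, by omega⟩ : Fin (Fintype.card S)) := by
          ext j
          simp only [Finset.mem_Iio, Finset.mem_Iic, Fin.lt_def, Fin.le_def]
          omega
        rw [this]
        exact h _ hlt
  rw [hs, Equiv.symm_apply_eq, hpred]
  constructor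
  · intro h
    rw [← h]
    refine ⟨fun j hj => ?_, ?_⟩
    · by_contra hlt
      exact absurd (Finset.min'_le _ j (by simpa using hlt)) (not_le.2 hj)
    · simpa using Finset.min'_mem _ hne
  · rintro ⟨h2, h3⟩
    refine le_antisymm (Finset.min'_le _ _ (by simpa using h3)) ?_
    refine Finset.le_min' _ _ _ fun j hj => ?_
    by_contra hlt
    have := h2 j (not_le.1 hlt)
    simp only [Finset.mem_filter, Finset.mem_univ, true_and] at hj
    linarith

lemma sum_Iic_eq_sum_Iio_add {n : ℕ} (f : Fin n → ℝ) (i : Fin n) :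
    ∑ j ∈ Finset.Iic i, f j = ∑ j ∈ Finset.Iio i, f j + f i := by
  rw [← Finset.Iio_insert, Finset.sum_insert (by simp), add_comm]

/-- Sampling only returns outcomes of positive probability. -/
lemma sample_pos {q : S → ℝ} (hq : IsDist q) {u : ℝ} (h0 : 0 ≤ u) (h1 : u < 1) :
    0 < q (sample q u) := by
  obtain ⟨h2, h3⟩ := (sample_eq_iff hq h0 h1 _).1 rfl
  rw [sum_Iic_eq_sum_Iio_add, Equiv.symm_apply_apply] at h3
  linarith

lemma measurableSet_sample (q : S → ℝ) (s : S) : MeasurableSet {u | sample q u = s} := by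
  classical
  let e := Fintype.equivFin S
  let G : (Fin (Fintype.card S) → Prop) → S := fun b =>
    if h : (Finset.univ.filter fun i => b i).Nonempty then
      e.symm ((Finset.univ.filter fun i => b i).min' h)
    else Classical.arbitrary S
  have hG : sample q = G ∘ fun u i => u < ∑ j ∈ Finset.Iic i, q (e.symm j) := by
    funext u
    simp only [sample, G, Function.comp, e]
  have hm : Measurable fun (u : ℝ) (i : Fin (Fintype.card S)) =>
      u < ∑ j ∈ Finset.Iic i, q (e.symm j) :=
    measurable_pi_lambda _ fun i => measurableSet_setOfPred.1 measurableSet_Iio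
  have : {u | sample q u = s} =
      (fun u i => u < ∑ j ∈ Finset.Iic i, q (e.symm j)) ⁻¹' {b | G b = s} := by
    ext u
    simp [hG]
  rw [this]
  exact hm (Set.to_countable _).measurableSet

lemma seedMeasure_sample {q : S → ℝ} (hq : IsDist q) (s : S) :
    seedMeasure {u | sample q u = s} = ENNReal.ofReal (q s) := by
  rw [seedMeasure_eq, Measure.restrict_apply' measurableSet_Ico]
  set a := ∑ j ∈ Finset.Iio (Fintype.equivFin S s), q ((Fintype.equivFin S).symm j) with ha
  have hsum := sum_Iic_eq_sum_Iio_add (fun j => q ((Fintype.equivFin S).symm j))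
    (Fintype.equivFin S s)
  simp only [Equiv.symm_apply_apply, ← ha] at hsum
  have ha0 : 0 ≤ a := Finset.sum_nonneg fun _ _ => hq.1 _
  have ha1 : a + q s ≤ 1 := by
    rw [← hsum, ← hq.2, ← Equiv.sum_comp (Fintype.equivFin S).symm q]
    exact Finset.sum_le_sum_of_subset_of_nonneg (Finset.subset_univ _) fun _ _ _ => hq.1 _
  have : {u | sample q u = s} ∩ Set.Ico 0 1 = Set.Ico a (a + q s) := by
    ext u
    simp only [Set.mem_inter_iff, Set.mem_ofPred_eq, Set.mem_Ico]
    constructor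
    · rintro ⟨h, h0, h1⟩
      have := (sample_eq_iff hq h0 h1 s).1 h
      rwa [hsum] at this
    · rintro ⟨h2, h3⟩
      have h0 : 0 ≤ u := ha0.trans h2
      have h1 : u < 1 := h3.trans_le ha1
      refine ⟨(sample_eq_iff hq h0 h1 s).2 ?_, h0, h1⟩
      rw [hsum]
      exact ⟨h2, h3⟩
  rw [this, Real.volume_Ico, add_sub_cancel_left]

end Sampling

/-- The filtration generated by the samples extracted from the seed. -/
noncomputable def seedFiltration : Filtration ℕ (inferInstance : MeasurableSpace ℝ) :=
  Filtration.natural unif fun k => (measurable_unif k).stronglyMeasurable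

lemma measurableSet_seedFiltration {n : ℕ} {D : Set ℝ} (hD : MeasurableSet[seedFiltration n] D) :
    MeasurableSet D :=
  seedFiltration.le n D hD

lemma measurableSet_sample_unif {S : Type} [Fintype S] [Nonempty S] (q : S → ℝ) (s : S) {k n : ℕ}
    (hkn : k ≤ n) : MeasurableSet[seedFiltration n] {x | sample q (unif k x) = s} := by
  refine seedFiltration.mono hkn _ ?_
  have h : Measurable[seedFiltration k] (unif k) :=
    (Filtration.stronglyAdapted_natural (fun k => (measurable_unif k).stronglyMeasurable)
      k).measurable
  exact h (measurableSet_sample q s)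

lemma seedMeasure_inter_sample {S : Type} [Fintype S] [Nonempty S] {q : S → ℝ} (hq : IsDist q)
    (s : S) {n k : ℕ} (hnk : n < k) {D : Set ℝ} (hD : MeasurableSet[seedFiltration n] D) :
    seedMeasure.real (D ∩ {x | sample q (unif k x) = s}) = seedMeasure.real D * q s := by
  have hind := iIndepFun.indep_comap_natural_of_lt
    (fun k => (measurable_unif k).stronglyMeasurable) iIndepFun_unif hnk
  have h := (Indep_iff _ _ _).1 hind _ D ⟨_, measurableSet_sample q s, rfl⟩ hD
  have hmap : seedMeasure (unif k ⁻¹' {u | sample q u = s}) = ENNReal.ofReal (q s) := by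
    rw [← Measure.map_apply (measurable_unif k) (measurableSet_sample q s), map_unif_apply,
      seedMeasure_sample hq]
  rw [hmap] at h
  rw [Set.inter_comm, measureReal_def, measureReal_def, mul_comm]
  have h' := congrArg ENNReal.toReal h
  rw [ENNReal.toReal_mul, ENNReal.toReal_ofReal (hq.1 s)] at h'
  exact h'

lemma ae_unif_lt_one : ∀ᵐ x ∂seedMeasure, ∀ k, unif k x < 1 := by
  rw [ae_all_iff]
  intro k
  refine ae_of_ae_map (measurable_unif k).aemeasurable (p := fun u => u < 1) ?_
  rw [map_unif_apply, seedMeasure_eq]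
  filter_upwards [ae_restrict_mem measurableSet_Ico] with x hx using hx.2

section Run

variable {V A : Type} [Fintype V] [Fintype A]

lemma Strategy.isDist {M : MDP V A} (σ : M.Strategy) (h : List (V × A)) (v : V) :
    IsDist (σ.act h v) :=
  ⟨σ.act_nonneg h v, σ.act_sum h v⟩

lemma isDist_p (M : MDP V A) {v : V} {a : A} (ha : a ∈ M.enabled v) : IsDist (M.p v a) :=
  ⟨M.p_nonneg v a, M.p_sum v a ha⟩

variable [Nonempty V] [Nonempty A] (M : MDP V A) (σ : M.Strategy) (α : V → ℝ)

lemma run_action (x : ℝ) (n : ℕ) : (M.run σ α x n).2.2 =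
    sample (σ.act (M.run σ α x n).1 (M.run σ α x n).2.1) (unif (2 * n + 1) x) := by
  cases n <;> rfl

lemma run_succ_state (x : ℝ) (n : ℕ) : (M.run σ α x (n + 1)).2.1 =
    sample (M.p (M.run σ α x n).2.1 (M.run σ α x n).2.2) (unif (2 * n + 2) x) := rfl

lemma measurableSet_run (n : ℕ) (r : List (V × A) × (V × A)) :
    MeasurableSet[seedFiltration (2 * n + 1)] {x | M.run σ α x n = r} := by
  induction n generalizing r with
  | zero =>
    obtain ⟨h, s, a⟩ := r
    have : {x | M.run σ α x 0 = (h, s, a)} = {x | ([] : List (V × A)) = h} ∩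
        ({x | sample α (unif 0 x) = s} ∩ {x | sample (σ.act [] s) (unif 1 x) = a}) := by
      ext x
      simp only [run, Prod.mk.injEq, Set.mem_ofPred_eq, Set.mem_inter_iff]
      refine and_congr_right fun _ => and_congr_right fun h => ?_
      rw [h]
    rw [this]
    exact (MeasurableSet.const _).inter ((measurableSet_sample_unif _ _ (by omega)).inter
      (measurableSet_sample_unif _ _ (by omega)))
  | succ n ih =>
    obtain ⟨h, s, a⟩ := r
    have : {x | M.run σ α x (n + 1) = (h, s, a)} = ⋃ r : List (V × A) × (V × A),
        {x | M.run σ α x n = r} ∩ ({x | r.2 :: r.1 = h} ∩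
        ({x | sample (M.p r.2.1 r.2.2) (unif (2 * n + 2) x) = s} ∩
          {x | sample (σ.act h s) (unif (2 * n + 3) x) = a})) := by
      ext x
      simp only [run, Prod.mk.injEq, Set.mem_ofPred_eq, Set.mem_inter_iff, Set.mem_iUnion,
        exists_eq_left']
      refine and_congr_right fun h1 => and_congr_right fun h2 => ?_
      rw [h1, h2]
    rw [this]
    refine MeasurableSet.iUnion fun r => (seedFiltration.mono (by omega) _ (ih r)).inter ?_
    exact (MeasurableSet.const _).inter ((measurableSet_sample_unif _ _ (by omega)).inter
      (measurableSet_sample_unif _ _ (by omega)))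

lemma measurableSet_run_pred (n : ℕ) (Q : List (V × A) × (V × A) → Prop) :
    MeasurableSet[seedFiltration (2 * n + 1)] {x | Q (M.run σ α x n)} := by
  have : {x | Q (M.run σ α x n)} = ⋃ r : List (V × A) × (V × A),
      {x | M.run σ α x n = r} ∩ {x | Q r} := by
    ext x
    simp
  rw [this]
  exact MeasurableSet.iUnion fun r => (measurableSet_run M σ α n r).inter (MeasurableSet.const _)

lemma measurableSet_state (n : ℕ) (v : V) :
    MeasurableSet[seedFiltration (2 * n)] {x | M.stateAt σ α x n = v} := by
  cases n with
  | zero => exact measurableSet_sample_unif α v (by omega)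
  | succ n =>
    have : {x | M.stateAt σ α x (n + 1) = v} = ⋃ r : List (V × A) × (V × A),
        {x | M.run σ α x n = r} ∩
        {x | sample (M.p r.2.1 r.2.2) (unif (2 * n + 2) x) = v} := by
      ext x
      simp [stateAt, run_succ_state]
    rw [this]
    exact MeasurableSet.iUnion fun r =>
      (seedFiltration.mono (by omega) _ (measurableSet_run M σ α n r)).inter
      (measurableSet_sample_unif _ _ (by omega))

/-- The probability of being in state `v` at time `n`. -/
noncomputable def stateProb (n : ℕ) (v : V) : ℝ :=
  seedMeasure.real {x | M.stateAt σ α x n = v}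

/-- The probability of being in state `v` and choosing action `a` at time `n`. -/
noncomputable def stateActionProb (n : ℕ) (v : V) (a : A) : ℝ :=
  seedMeasure.real {x | (M.run σ α x n).2 = (v, a)}

lemma run_enabled {x : ℝ} (hx : ∀ k, unif k x < 1) (n : ℕ) :
    (M.run σ α x n).2.2 ∈ M.enabled (M.run σ α x n).2.1 := by
  by_contra h
  have h1 := sample_pos (σ.isDist (M.run σ α x n).1 (M.run σ α x n).2.1)
    (unif_nonneg (2 * n + 1) x) (hx _)
  rw [← run_action, σ.act_support _ _ _ h] at h1
  exact h1.false

lemma stateProb_zero (hα : IsDist α) (v : V) : M.stateProb σ α 0 v = α v := by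
  have h : seedMeasure (unif 0 ⁻¹' {u | sample α u = v}) = ENNReal.ofReal (α v) := by
    rw [← Measure.map_apply (measurable_unif 0) (measurableSet_sample α v), map_unif_apply,
      seedMeasure_sample hα]
  have h' := congrArg ENNReal.toReal h
  rw [ENNReal.toReal_ofReal (hα.1 v)] at h'
  exact h'

lemma stateActionProb_nonneg (n : ℕ) (v : V) (a : A) : 0 ≤ M.stateActionProb σ α n v a :=
  measureReal_nonneg

lemma stateProb_nonneg (n : ℕ) (v : V) : 0 ≤ M.stateProb σ α n v :=
  measureReal_nonneg

lemma stateActionProb_eq_zero (n : ℕ) {v : V} {a : A} (ha : a ∉ M.enabled v) :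
    M.stateActionProb σ α n v a = 0 := by
  have : seedMeasure {x | (M.run σ α x n).2 = (v, a)} = 0 := by
    refine measure_mono_null ?_ (ae_iff.1 ae_unif_lt_one)
    intro x hx hx'
    have := M.run_enabled σ α hx' n
    rw [show (M.run σ α x n).2 = (v, a) from hx] at this
    exact ha this
  rw [stateActionProb, measureReal_def, this, ENNReal.toReal_zero]

lemma measureReal_eq_sum_fibers {Ω ι : Type*} [MeasurableSpace Ω] {μ : Measure Ω}
    [IsFiniteMeasure μ] [Fintype ι] {f : Ω → ι} (hf : ∀ i, MeasurableSet {x | f x = i})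
    (D : Set Ω) : μ.real D = ∑ i, μ.real (D ∩ {x | f x = i}) := by
  have h := sum_measureReal_preimage_singleton (μ := μ.restrict D) Finset.univ (f := f)
    fun i _ => hf i
  simp only [Finset.coe_univ, Set.preimage_univ, measureReal_restrict_apply_univ] at h
  rw [← h]
  refine Finset.sum_congr rfl fun i _ => ?_
  rw [Set.inter_comm]
  exact measureReal_restrict_apply (hf i)

lemma stateProb_eq_sum (n : ℕ) (v : V) :
    M.stateProb σ α n v = ∑ a, M.stateActionProb σ α n v a := by
  rw [stateProb, measureReal_eq_sum_fibers (f := fun x => (M.run σ α x n).2.2) fun a =>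
    measurableSet_seedFiltration (M.measurableSet_run_pred σ α n fun r => r.2.2 = a)]
  refine Finset.sum_congr rfl fun a _ => ?_
  rw [stateActionProb]
  congr 1
  ext x
  simp [stateAt, Prod.ext_iff]

lemma stateProb_succ (n : ℕ) (w : V) : M.stateProb σ α (n + 1) w =
    ∑ v, ∑ a, M.stateActionProb σ α n v a * M.p v a w := by
  rw [stateProb, measureReal_eq_sum_fibers (f := fun x => (M.run σ α x n).2) fun a =>
    measurableSet_seedFiltration (M.measurableSet_run_pred σ α n fun r => r.2 = a),
    Fintype.sum_prod_type]
  refine Finset.sum_congr rfl fun v _ => Finset.sum_congr rfl fun a _ => ?_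
  by_cases ha : a ∈ M.enabled v
  · rw [stateActionProb, ← seedMeasure_inter_sample (M.isDist_p ha) w
      (n := 2 * n + 1) (k := 2 * n + 2) (by omega)
      (M.measurableSet_run_pred σ α n fun r => r.2 = (v, a))]
    congr 1
    ext x
    simp only [Set.mem_inter_iff, Set.mem_ofPred_eq, stateAt, run_succ_state]
    rw [and_comm]
    refine and_congr_right fun h => ?_
    rw [h]
  · rw [M.stateActionProb_eq_zero σ α n ha, zero_mul]
    refine le_antisymm ?_ measureReal_nonneg
    rw [← M.stateActionProb_eq_zero σ α n ha]
    exact measureReal_mono Set.inter_subset_right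

lemma stateActionProb_of_memoryless (hσ : σ.Memoryless) (n : ℕ) (v : V) (a : A) :
    M.stateActionProb σ α n v a = M.stateProb σ α n v * σ.act [] v a := by
  rw [stateProb, ← seedMeasure_inter_sample (σ.isDist [] v) a
    (n := 2 * n) (k := 2 * n + 1) (by omega) (M.measurableSet_state σ α n v), stateActionProb]
  congr 1
  ext x
  simp only [Set.mem_inter_iff, Set.mem_ofPred_eq, stateAt, Prod.ext_iff]
  refine and_congr_right fun h => ?_
  rw [run_action, h, hσ _ []]

lemma stateAt_succ_of_absorbing {x : ℝ} (hx : ∀ k, unif k x < 1) {n : ℕ}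
    (hv : M.Absorbing (M.stateAt σ α x n)) : M.stateAt σ α x (n + 1) = M.stateAt σ α x n := by
  classical
  obtain ⟨a, ha, hp⟩ := hv
  have hen := M.run_enabled σ α hx n
  have hpos := sample_pos (M.isDist_p hen) (unif_nonneg (2 * n + 2) x) (hx _)
  rw [← run_succ_state] at hpos
  unfold stateAt at *
  have hact : (M.run σ α x n).2.2 = a := by simpa [ha] using hen
  rw [hact] at hpos hen
  by_contra hne
  have hsum := M.p_sum _ _ hen
  have := Finset.add_le_sum (fun v _ => M.p_nonneg (M.run σ α x n).2.1 a v)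
    (Finset.mem_univ (M.run σ α x (n + 1)).2.1) (Finset.mem_univ (M.run σ α x n).2.1) hne
  linarith

lemma tendsto_sum_stateProb {T : Finset V} (hT : ∀ v ∈ T, M.Absorbing v) :
    Tendsto (fun n => ∑ v ∈ T, M.stateProb σ α n v) atTop (nhds (M.PrReach σ α (↑T : Set V))) := by
  classical
  set G : Set ℝ := {x | ∀ k, unif k x < 1}
  set S : ℕ → Set ℝ := fun n => {x | M.stateAt σ α x n ∈ T} with hS
  have hG : ∀ D : Set ℝ, seedMeasure (D ∩ G) = seedMeasure D := fun D =>
    measure_congr (inter_ae_eq_left_of_ae_eq_univ (eventuallyEq_univ.2 ae_unif_lt_one))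
  have hsum : ∀ n, ∑ v ∈ T, M.stateProb σ α n v = (seedMeasure (S n ∩ G)).toReal := by
    intro n
    rw [hG]
    exact sum_measureReal_preimage_singleton T (f := fun x => M.stateAt σ α x n) fun v _ =>
      measurableSet_seedFiltration (M.measurableSet_state σ α n v)
  have hreach : M.PrReach σ α (↑T : Set V) = (seedMeasure (⋃ n, S n ∩ G)).toReal := by
    rw [← Set.iUnion_inter, hG, PrReach, PrEvent, seedMeasure,
      Measure.restrict_apply' measurableSet_Icc]
    congr 2
    ext x
    simp [hS, and_comm]
  have hmono : Monotone fun n => S n ∩ G := by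
    refine monotone_nat_of_le_succ fun n x hx => ⟨?_, hx.2⟩
    change M.stateAt σ α x (n + 1) ∈ T
    rw [M.stateAt_succ_of_absorbing σ α hx.2 (hT _ hx.1)]
    exact hx.1
  simp_rw [hsum]
  rw [hreach]
  exact (ENNReal.tendsto_toReal (measure_ne_top _ _)).comp (tendsto_measure_iUnion_atTop hmono)

end Run

end MDP

/-- The **Farkas lemma** for finitely many linear functionals on a real vector space. -/
theorem exists_nonneg_combination_of_forall_nonpos {W ι : Type*} [AddCommGroup W] [Module ℝ W]
    (s : Finset ι) (a : ι → W →ₗ[ℝ] ℝ) (b : W →ₗ[ℝ] ℝ)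
    (h : ∀ x, (∀ i ∈ s, a i x ≤ 0) → b x ≤ 0) :
    ∃ c : ι → ℝ, (∀ i, 0 ≤ c i) ∧ b = ∑ i ∈ s, c i • a i := by
  classical
  induction s using Finset.induction_on generalizing a b with
  | empty =>
    refine ⟨0, fun _ => le_rfl, LinearMap.ext fun x => ?_⟩
    have h1 := h x (by simp)
    have h2 := h (-x) (by simp)
    rw [map_neg] at h2
    simp only [Finset.sum_empty, LinearMap.zero_apply]
    linarith
  | insert j s hj ih =>
    by_cases hs : ∀ x, (∀ i ∈ s, a i x ≤ 0) → b x ≤ 0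
    · obtain ⟨c, hc, hb⟩ := ih a b hs
      refine ⟨Function.update c j 0, fun i => ?_, ?_⟩
      · by_cases hij : i = j
        · subst hij; simp
        · simpa [hij] using hc i
      · rw [Finset.sum_insert hj, Function.update_self, zero_smul, zero_add, hb]
        refine Finset.sum_congr rfl fun i hi => ?_
        rw [Function.update_of_ne (by rintro rfl; exact hj hi)]
    · push Not at hs
      obtain ⟨y, hy, hby⟩ := hs
      have hjy : 0 < a j y := by
        by_contra hle
        refine absurd (h y fun i hi => ?_) (not_le.2 hby)
        rcases Finset.mem_insert.1 hi with rfl | hi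
        · exact not_lt.1 hle
        · exact hy i hi
      let t : W := (a j y)⁻¹ • y
      have hjt : a j t = 1 := by
        simp only [t, map_smul, smul_eq_mul]
        exact inv_mul_cancel₀ hjy.ne'
      have ht : ∀ i ∈ s, a i t ≤ 0 := fun i hi => by
        simp only [t, map_smul, smul_eq_mul]
        exact mul_nonpos_of_nonneg_of_nonpos (inv_nonneg.2 hjy.le) (hy i hi)
      have hbt : 0 < b t := by
        simp only [t, map_smul, smul_eq_mul]
        positivity
      obtain ⟨c, hc, hb⟩ := ih (fun i => a i - a i t • a j) (b - b t • a j) (by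
        intro x hx
        have key := h (x - a j x • t) (by
          intro i hi
          rcases Finset.mem_insert.1 hi with rfl | hi
          · simp [hjt]
          · have := hx i hi
            simp only [LinearMap.sub_apply, LinearMap.smul_apply, smul_eq_mul] at this
            simp only [map_sub, map_smul, smul_eq_mul]
            linarith)
        simp only [map_sub, map_smul, smul_eq_mul] at key
        simp only [LinearMap.sub_apply, LinearMap.smul_apply, smul_eq_mul]
        linarith)
      refine ⟨Function.update c j (b t - ∑ i ∈ s, c i * a i t), fun i => ?_, ?_⟩
      · by_cases hij : i = j
        · subst hij
          rw [Function.update_self]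
          have : ∑ l ∈ s, c l * a l t ≤ 0 :=
            Finset.sum_nonpos fun l hl => mul_nonpos_of_nonneg_of_nonpos (hc l) (ht l hl)
          linarith
        · simpa [hij] using hc i
      · rw [Finset.sum_insert hj, Function.update_self]
        have hrest : ∑ i ∈ s, Function.update c j (b t - ∑ i ∈ s, c i * a i t) i • a i =
            ∑ i ∈ s, c i • a i := by
          refine Finset.sum_congr rfl fun i hi => ?_
          rw [Function.update_of_ne (by rintro rfl; exact hj hi)]
        rw [hrest]
        ext x
        have := LinearMap.congr_fun hb x
        simp only [LinearMap.sub_apply, LinearMap.smul_apply, smul_eq_mul, LinearMap.sum_apply,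
          mul_sub, Finset.sum_sub_distrib] at this
        simp only [LinearMap.add_apply, LinearMap.smul_apply, smul_eq_mul, LinearMap.sum_apply,
          sub_mul, Finset.sum_mul]
        simp only [← mul_assoc] at this
        linarith

/-- In a finite Markov chain that is absorbing on `F`, any nonnegative solution `Y` of the flow
equations off `F` determines the limiting probabilities of the states of `F`. -/
theorem tendsto_absorbed_of_flow {V : Type*} [Fintype V] [DecidableEq V] (F : Finset V)
    (P : V → V → ℝ) (hP : ∀ u v, 0 ≤ P u v) (hsum : ∀ u, ∑ v, P u v = 1)
    (hF : ∀ f ∈ F, P f f = 1) (μ : ℕ → V → ℝ) (hμF : ∀ f ∈ F, μ 0 f = 0)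
    (hμ : ∀ n v, μ (n + 1) v = ∑ u, μ n u * P u v) (Y : V → ℝ) (hY0 : ∀ v ∉ F, 0 ≤ Y v)
    (hY : ∀ v ∉ F, Y v = μ 0 v + ∑ u ∈ Fᶜ, Y u * P u v) {f : V} (hf : f ∈ F) :
    Filter.Tendsto (fun n => μ n f) Filter.atTop (nhds (∑ u ∈ Fᶜ, Y u * P u f)) := by
  have hPF : ∀ g ∈ F, ∀ v, v ≠ g → P g v = 0 := by
    intro g hg v hvg
    have := Finset.add_le_sum (fun w _ => hP g w) (Finset.mem_univ v) (Finset.mem_univ g) hvg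
    rw [hsum, hF g hg] at this
    linarith [hP g v]
  have hout : ∀ n, ∀ v ∉ F, μ (n + 1) v = ∑ u ∈ Fᶜ, μ n u * P u v := by
    intro n v hv
    rw [hμ, ← Finset.sum_add_sum_compl F, Finset.sum_eq_zero, zero_add]
    intro u hu
    rw [hPF u hu v (fun h => hv (h ▸ hu)), mul_zero]
  have hin : ∀ n, ∀ g ∈ F, μ (n + 1) g = μ n g + ∑ u ∈ Fᶜ, μ n u * P u g := by
    intro n g hg
    rw [hμ, ← Finset.sum_add_sum_compl F, Finset.sum_eq_single_of_mem g hg, hF g hg, mul_one]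
    intro u hu hne
    rw [hPF u hu g hne.symm, mul_zero]
  set z : ℕ → V → ℝ := fun n v => Y v - ∑ t ∈ Finset.range (n + 1), μ t v with hz
  have hzsucc : ∀ n, ∀ v ∉ F, z (n + 1) v = ∑ u ∈ Fᶜ, z n u * P u v := by
    intro n v hv
    simp only [hz, sub_mul, Finset.sum_sub_distrib, Finset.sum_mul]
    rw [Finset.sum_range_succ', hY v hv, Finset.sum_comm]
    simp only [hout _ v hv]
    ring
  have hz0 : ∀ n, ∀ v ∉ F, 0 ≤ z n v := by
    intro n
    induction n with
    | zero =>
      intro v hv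
      have h1 := hY v hv
      have h2 : 0 ≤ ∑ u ∈ Fᶜ, Y u * P u v :=
        Finset.sum_nonneg fun u hu => mul_nonneg (hY0 u (Finset.mem_compl.1 hu)) (hP u v)
      simp only [hz, zero_add, Finset.sum_range_one]
      linarith
    | succ n ih =>
      intro v hv
      rw [hzsucc n v hv]
      exact Finset.sum_nonneg fun u hu => mul_nonneg (ih u (Finset.mem_compl.1 hu)) (hP u v)
  set d : ℕ → V → ℝ := fun n g => ∑ u ∈ Fᶜ, z n u * P u g with hd
  have hd0 : ∀ n g, 0 ≤ d n g := fun n g =>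
    Finset.sum_nonneg fun u hu => mul_nonneg (hz0 n u (Finset.mem_compl.1 hu)) (hP u g)
  have hdμ : ∀ n, μ (n + 1) f = ∑ u ∈ Fᶜ, Y u * P u f - d n f := by
    intro n
    have hmass : ∀ n, μ n f = ∑ t ∈ Finset.range n, ∑ u ∈ Fᶜ, μ t u * P u f := by
      intro n
      induction n with
      | zero => simp [hμF f hf]
      | succ n ih => rw [hin n f hf, Finset.sum_range_succ, ih]
    simp only [hd, hz, sub_mul, Finset.sum_sub_distrib, Finset.sum_mul]
    rw [hmass, Finset.sum_comm]
    ring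
  set Z : ℕ → ℝ := fun n => ∑ v ∈ Fᶜ, z n v with hZ
  have hZd : ∀ n, Z n - Z (n + 1) = ∑ g ∈ F, d n g := by
    intro n
    have h1 : Z (n + 1) = ∑ u ∈ Fᶜ, ∑ v ∈ Fᶜ, z n u * P u v := by
      rw [Finset.sum_comm]
      exact Finset.sum_congr rfl fun v hv => hzsucc n v (Finset.mem_compl.1 hv)
    have h2 : ∑ g ∈ F, d n g = ∑ u ∈ Fᶜ, ∑ g ∈ F, z n u * P u g := Finset.sum_comm
    rw [h1, h2, sub_eq_iff_eq_add, ← Finset.sum_add_distrib]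
    refine Finset.sum_congr rfl fun u _ => ?_
    rw [Finset.sum_add_sum_compl, ← Finset.mul_sum, hsum, mul_one]
  have hZanti : Antitone Z := antitone_nat_of_succ_le fun n => by
    have := Finset.sum_nonneg fun g (_ : g ∈ F) => hd0 n g
    linarith [hZd n]
  have hZbdd : BddBelow (Set.range Z) := by
    refine ⟨0, ?_⟩
    rintro _ ⟨n, rfl⟩
    exact Finset.sum_nonneg fun v hv => hz0 n v (Finset.mem_compl.1 hv)
  have hlim := tendsto_atTop_ciInf hZanti hZbdd
  have hdiff : Filter.Tendsto (fun n => Z n - Z (n + 1)) Filter.atTop (nhds 0) := by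
    simpa using hlim.sub (hlim.comp (Filter.tendsto_add_atTop_nat 1))
  have hdlim : Filter.Tendsto (fun n => d n f) Filter.atTop (nhds 0) := by
    refine squeeze_zero (fun n => hd0 n f) (fun n => ?_) hdiff
    rw [hZd]
    exact Finset.single_le_sum (fun g _ => hd0 n g) hf
  rw [← Filter.tendsto_add_atTop_iff_nat 1]
  simp_rw [hdμ]
  simpa using tendsto_const_nhds.sub hdlim

namespace MDP

variable {V A : Type} [Fintype V] [Fintype A]

/-- A function superharmonic off `F` and nonnegative on `F` is nonnegative in a cleaned-up MDP. -/
lemma nonneg_of_superharmonic [Nonempty V] (M : MDP V A) {F : Finset V}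
    (hclean : M.CleanedUp (↑F : Set V)) {z : V → ℝ} (hzF : ∀ v ∈ F, 0 ≤ z v)
    (hz : ∀ v ∉ F, ∀ a ∈ M.enabled v, ∑ w, M.p v a w * z w ≤ z v) (v : V) : 0 ≤ z v := by
  obtain ⟨v₀, hv₀⟩ := Finite.exists_min z
  refine le_trans ?_ (hv₀ v)
  by_contra hneg
  push Not at hneg
  obtain ⟨w, hwF, hw⟩ := hclean v₀
  have hmin : ∀ u, Relation.ReflTransGen M.Step v₀ u → z u = z v₀ := by
    intro u hu
    induction hu with
    | refl => rfl
    | @tail u u' _ hstep ih =>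
      have huF : u ∉ F := fun huF => by linarith [hzF u huF]
      obtain ⟨a, ha, hp⟩ := hstep
      have hnonneg : ∀ t, 0 ≤ M.p u a t * (z t - z v₀) := fun t =>
        mul_nonneg (M.p_nonneg u a t) (sub_nonneg.2 (hv₀ t))
      have hle : ∑ t, M.p u a t * (z t - z v₀) ≤ 0 := by
        have := hz u huF a ha
        simp only [mul_sub, Finset.sum_sub_distrib, ← Finset.sum_mul, M.p_sum u a ha]
        linarith
      have hu' := Finset.single_le_sum (fun t _ => hnonneg t) (Finset.mem_univ u')
      have hzero := le_antisymm (hu'.trans hle) (hnonneg u')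
      rcases mul_eq_zero.1 hzero with h | h
      · exact absurd h hp.ne'
      · exact sub_eq_zero.1 h
  linarith [hzF w hwF, hmin w hw]

/-- A solution of the LP yields a memoryless strategy with the same reachability values. -/
lemma exists_memoryless_of_feasible [Nonempty V] [Nonempty A] [DecidableEq V] (M : MDP V A)
    {F : Finset V} (habs : ∀ v ∈ F, M.Absorbing v) {α : V → ℝ} (hα : IsDist α)
    (hsupp : ∀ v ∈ F, α v = 0) {y : V → A → ℝ} {yF : V → ℝ} (hy : M.LPFeasible α F y yF) :
    ∃ σ : M.Strategy, σ.Memoryless ∧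
      ∀ T ⊆ F, M.PrReach σ α (↑T : Set V) = ∑ v ∈ T, yF v := by
  classical
  obtain ⟨hflow, hflowF, -, hy0⟩ := hy
  set Y : V → ℝ := fun v => ∑ a ∈ M.enabled v, y v a with hYdef
  choose b hb using M.enabled_nonempty
  let q : V → A → ℝ := fun v a =>
    if v ∉ F ∧ 0 < Y v then (if a ∈ M.enabled v then y v a / Y v else 0)
    else if a = b v then 1 else 0
  have hq0 : ∀ v a, 0 ≤ q v a := by
    intro v a
    simp only [q]
    split_ifs with h1 h2
    · exact div_nonneg (hy0 v h1.1 a h2) h1.2.le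
    all_goals norm_num
  have hqsupp : ∀ v a, a ∉ M.enabled v → q v a = 0 := by
    intro v a ha
    have hab : a ≠ b v := fun h => ha (h ▸ hb v)
    simp [q, ha, hab]
  have hqsum : ∀ v, ∑ a, q v a = 1 := by
    intro v
    simp only [q]
    split_ifs with h1
    · rw [Finset.sum_ite_mem, Finset.univ_inter, ← Finset.sum_div]
      exact div_self h1.2.ne'
    · simp
  have hqY : ∀ v ∉ F, ∀ a ∈ M.enabled v, Y v * q v a = y v a := by
    intro v hv a ha
    by_cases hpos : 0 < Y v
    · simp only [q, hv, hpos, ha, not_false_eq_true, and_self, if_true]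
      field_simp
    · have hY : Y v = 0 := le_antisymm (not_lt.1 hpos) (Finset.sum_nonneg (hy0 v hv))
      rw [hY, zero_mul]
      exact ((Finset.sum_eq_zero_iff_of_nonneg (hy0 v hv)).1 hY a ha).symm
  let σ : M.Strategy := ⟨fun _ => q, fun _ => hq0, fun _ => hqsupp, fun _ => hqsum⟩
  have hσ : σ.Memoryless := fun _ _ _ => rfl
  refine ⟨σ, hσ, fun T hT => ?_⟩
  let P : V → V → ℝ := fun u v => ∑ a, q u a * M.p u a v
  have hYP : ∀ v, ∑ u ∈ Fᶜ, Y u * P u v =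
      ∑ u ∈ Fᶜ, ∑ a ∈ M.enabled u, M.p u a v * y u a := by
    intro v
    refine Finset.sum_congr rfl fun u hu => ?_
    simp only [P]
    rw [← Finset.sum_subset (Finset.subset_univ (M.enabled u))
      (fun a _ ha => by rw [hqsupp u a ha, zero_mul]), Finset.mul_sum]
    refine Finset.sum_congr rfl fun a ha => ?_
    rw [← mul_assoc, hqY u (Finset.mem_compl.1 hu) a ha, mul_comm]
  have hlim : ∀ f ∈ F, Filter.Tendsto (fun n => M.stateProb σ α n f) Filter.atTop
      (nhds (yF f)) := by
    intro f hf
    have := hflowF f hf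
    rw [← hYP, sub_eq_zero] at this
    rw [this]
    refine tendsto_absorbed_of_flow F P (fun u v => Finset.sum_nonneg fun a _ =>
      mul_nonneg (hq0 u a) (M.p_nonneg u a v)) (fun u => ?_) (fun g hg => ?_) _
      (fun g hg => by rw [M.stateProb_zero σ α hα, hsupp g hg])
      (fun n v => ?_) Y (fun v hv => Finset.sum_nonneg (hy0 v hv)) (fun v hv => ?_) hf
    · simp only [P]
      rw [Finset.sum_comm, ← hqsum u]
      refine Finset.sum_congr rfl fun a _ => ?_
      rw [← Finset.mul_sum]
      by_cases ha : a ∈ M.enabled u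
      · rw [M.p_sum u a ha, mul_one]
      · rw [hqsupp u a ha, zero_mul]
    · obtain ⟨a, ha, hpa⟩ := habs g hg
      simp only [P]
      rw [← hqsum g]
      refine Finset.sum_congr rfl fun c _ => ?_
      by_cases hc : c ∈ M.enabled g
      · rw [ha, Finset.mem_singleton] at hc
        rw [hc, hpa, mul_one]
      · rw [hqsupp g c hc, zero_mul]
    · rw [M.stateProb_succ]
      refine Finset.sum_congr rfl fun u _ => ?_
      simp only [P]
      rw [Finset.mul_sum]
      refine Finset.sum_congr rfl fun a _ => ?_
      rw [M.stateActionProb_of_memoryless σ α hσ, mul_assoc]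
    · rw [M.stateProb_zero σ α hα, hYP, ← hflow v hv]
      simp [Y]
  exact tendsto_nhds_unique (M.tendsto_sum_stateProb σ α fun v hv => habs v (hT hv))
    (tendsto_finsetSum T fun v hv => hlim v (hT hv))

end MDP

namespace MDP

variable {V A : Type} [Fintype V] [Fintype A]

/-- Along any strategy, the expectation of a superharmonic function does not increase. -/
lemma sum_stateProb_mul_le [Nonempty V] [Nonempty A] (M : MDP V A) (σ : M.Strategy) {α : V → ℝ}
    (hα : IsDist α) {z : V → ℝ} (hz : ∀ v, ∀ a ∈ M.enabled v, ∑ w, M.p v a w * z w ≤ z v) (n : ℕ) :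
    ∑ v, M.stateProb σ α n v * z v ≤ ∑ v, α v * z v := by
  induction n with
  | zero => simp only [M.stateProb_zero σ α hα, le_refl]
  | succ n ih =>
    refine le_trans ?_ ih
    have h1 : ∑ w, M.stateProb σ α (n + 1) w * z w =
        ∑ v, ∑ a, M.stateActionProb σ α n v a * ∑ w, M.p v a w * z w := by
      simp only [M.stateProb_succ, Finset.sum_mul, Finset.mul_sum]
      rw [Finset.sum_comm]
      refine Finset.sum_congr rfl fun v _ => ?_
      rw [Finset.sum_comm]
      simp only [mul_assoc]
    rw [h1]
    refine Finset.sum_le_sum fun v _ => ?_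
    rw [M.stateProb_eq_sum, Finset.sum_mul]
    refine Finset.sum_le_sum fun a _ => ?_
    by_cases ha : a ∈ M.enabled v
    · exact mul_le_mul_of_nonneg_left (hz v a ha) (M.stateActionProb_nonneg σ α n v a)
    · rw [M.stateActionProb_eq_zero σ α n ha, zero_mul, zero_mul]

lemma Absorbing.sum_p_mul {M : MDP V A} {v : V} (hv : M.Absorbing v) (z : V → ℝ) {a : A}
    (ha : a ∈ M.enabled v) : ∑ w, M.p v a w * z w = z v := by
  classical
  obtain ⟨b, hb, hp⟩ := hv
  have hab : a = b := by rwa [hb, Finset.mem_singleton] at ha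
  subst hab
  rw [Finset.sum_eq_single v, hp, one_mul]
  · intro w _ hw
    have := Finset.add_le_sum (fun w _ => M.p_nonneg v a w) (Finset.mem_univ w)
      (Finset.mem_univ v) hw
    rw [M.p_sum v a ha, hp] at this
    rw [le_antisymm (by linarith) (M.p_nonneg v a w), zero_mul]
  · simp

/-- Weak duality between reachability probabilities and superharmonic functions. -/
lemma sum_weight_mul_prReach_le [Nonempty V] [Nonempty A] [DecidableEq V] (M : MDP V A) {k : ℕ}
    {Fi : Fin k → Finset V} {F : Finset V} (hF : F = Finset.univ.biUnion Fi)
    (habs : ∀ v ∈ F, M.Absorbing v) (hclean : M.CleanedUp (↑F : Set V)) {α : V → ℝ}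
    (hα : IsDist α) (σ : M.Strategy) {z : V → ℝ} {w : Fin k → ℝ} (hw : ∀ i, 0 ≤ w i)
    (hz : ∀ v ∉ F, ∀ a ∈ M.enabled v, ∑ u, M.p v a u * z u ≤ z v)
    (hzF : ∀ f ∈ F, (∑ i, if f ∈ Fi i then w i else 0) ≤ z f) :
    ∑ i, w i * M.PrReach σ α (↑(Fi i) : Set V) ≤ ∑ v, α v * z v := by
  have hweight : ∀ f, 0 ≤ ∑ i, if f ∈ Fi i then w i else 0 := fun f =>
    Finset.sum_nonneg fun i _ => by split_ifs <;> simp [hw i]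
  have hz0 := M.nonneg_of_superharmonic hclean
    (fun f hf => (hweight f).trans (hzF f hf)) hz
  have hFi : ∀ i, Fi i ⊆ F := fun i => hF ▸ Finset.subset_biUnion_of_mem Fi (Finset.mem_univ i)
  have hle : ∀ v, (∑ i, if v ∈ Fi i then w i else 0) ≤ z v := by
    intro v
    by_cases hv : v ∈ F
    · exact hzF v hv
    · rw [Finset.sum_eq_zero fun i _ => if_neg fun h => hv (hFi i h)]
      exact hz0 v
  have hsuper : ∀ v, ∀ a ∈ M.enabled v, ∑ u, M.p v a u * z u ≤ z v := by
    intro v a ha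
    by_cases hv : v ∈ F
    · exact ((habs v hv).sum_p_mul z ha).le
    · exact hz v hv a ha
  refine le_of_tendsto (tendsto_finsetSum Finset.univ fun i _ =>
    (M.tendsto_sum_stateProb σ α fun v hv => habs v (hFi i hv)).const_mul (w i))
    (Filter.Eventually.of_forall fun n => ?_)
  refine le_trans (le_of_eq ?_) ((Finset.sum_le_sum fun v _ =>
    mul_le_mul_of_nonneg_left (hle v) (M.stateProb_nonneg σ α n v)).trans
    (M.sum_stateProb_mul_le σ hα hsuper n))
  simp only [Finset.mul_sum]
  rw [Finset.sum_comm]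
  refine Finset.sum_congr rfl fun i _ => ?_
  simp only [mul_ite, mul_zero, Finset.sum_ite_mem, Finset.univ_inter, mul_comm]

/-- Values achieved by an arbitrary strategy are achieved by a solution of the LP. -/
lemma exists_feasible_of_le_prReach [Nonempty V] [Nonempty A] [DecidableEq V] (M : MDP V A) {k : ℕ}
    {Fi : Fin k → Finset V} {F : Finset V} (hF : F = Finset.univ.biUnion Fi)
    (habs : ∀ v ∈ F, M.Absorbing v) (hclean : M.CleanedUp (↑F : Set V)) {α : V → ℝ}
    (hα : IsDist α) (hsupp : ∀ v ∈ F, α v = 0) {r : Fin k → ℝ} (σ : M.Strategy)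
    (hσ : ∀ i, r i ≤ M.PrReach σ α (↑(Fi i) : Set V)) :
    ∃ (y : V → A → ℝ) (yF : V → ℝ), M.LPFeasible α F y yF ∧ ∀ i, r i ≤ ∑ v ∈ Fi i, yF v := by
  classical
  let Z : V → ((V → ℝ) × (Fin k → ℝ)) →ₗ[ℝ] ℝ := fun v =>
    LinearMap.proj v ∘ₗ LinearMap.fst ℝ _ _
  let ω : Fin k → ((V → ℝ) × (Fin k → ℝ)) →ₗ[ℝ] ℝ := fun i =>
    LinearMap.proj i ∘ₗ LinearMap.snd ℝ _ _
  let col : (Σ _ : V, A) ⊕ (V ⊕ Fin k) → ((V → ℝ) × (Fin k → ℝ)) →ₗ[ℝ] ℝ :=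
    Sum.elim (fun e => Z e.1 - ∑ u, M.p e.1 e.2 u • Z u)
      (Sum.elim (fun f => Z f + ∑ i, if f ∈ Fi i then ω i else 0) fun i => -ω i)
  obtain ⟨c, hc, hb⟩ := exists_nonneg_combination_of_forall_nonpos
    ((Fᶜ.sigma M.enabled).disjSum (F.disjSum Finset.univ)) col
    (∑ v, α v • Z v + ∑ i, r i • ω i) (by
      rintro ⟨z, w⟩ hx
      have hw : ∀ i, 0 ≤ w i := fun i => by
        simpa [col, ω] using hx (Sum.inr (Sum.inr i)) (by simp)
      have key := M.sum_weight_mul_prReach_le hF habs hclean hα σ (z := -z) hw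
        (fun v hv a ha => by
          have := hx (Sum.inl ⟨v, a⟩) (by simp [hv, ha])
          simp only [col, Z, Sum.elim_inl, LinearMap.sub_apply, LinearMap.sum_apply,
            LinearMap.smul_apply, LinearMap.comp_apply, LinearMap.fst_apply, LinearMap.proj_apply,
            smul_eq_mul] at this
          simp only [Pi.neg_apply, mul_neg, Finset.sum_neg_distrib]
          linarith)
        (fun f hf => by
          have := hx (Sum.inr (Sum.inl f)) (by simp [hf])
          simp only [col, Z, ω, Sum.elim_inl, Sum.elim_inr, LinearMap.add_apply,
            LinearMap.sum_apply, apply_ite (fun l : ((V → ℝ) × (Fin k → ℝ)) →ₗ[ℝ] ℝ => l (z, w)),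
            LinearMap.zero_apply, LinearMap.comp_apply,
            LinearMap.fst_apply, LinearMap.snd_apply, LinearMap.proj_apply] at this
          simp only [Pi.neg_apply]
          linarith)
      have hr : ∑ i, r i * w i ≤ ∑ i, w i * M.PrReach σ α (↑(Fi i) : Set V) :=
        Finset.sum_le_sum fun i _ => by
          rw [mul_comm]
          exact mul_le_mul_of_nonneg_left (hσ i) (hw i)
      simp only [Pi.neg_apply, mul_neg, Finset.sum_neg_distrib] at key
      simp only [Z, ω, LinearMap.add_apply, LinearMap.sum_apply, LinearMap.smul_apply,
        LinearMap.comp_apply, LinearMap.fst_apply, LinearMap.snd_apply, LinearMap.proj_apply,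
        smul_eq_mul]
      linarith)
  rw [Finset.sum_disjSum, Finset.sum_disjSum, Finset.sum_sigma] at hb
  have hZ : ∀ v, α v = (if v ∈ F then 0 else ∑ a ∈ M.enabled v, c (Sum.inl ⟨v, a⟩)) -
      (∑ v' ∈ Fᶜ, ∑ a ∈ M.enabled v', M.p v' a v * c (Sum.inl ⟨v', a⟩)) +
      (if v ∈ F then c (Sum.inr (Sum.inl v)) else 0) := by
    intro v
    have := LinearMap.congr_fun hb (Pi.single v 1, 0)
    simp [col, Z, ω, LinearMap.sum_apply, Pi.single_apply, mul_sub, Finset.sum_sub_distrib,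
      apply_ite (fun l : ((V → ℝ) × (Fin k → ℝ)) →ₗ[ℝ] ℝ => l (Pi.single v 1, 0))] at this
    simp only [mul_comm (M.p _ _ _)]
    exact this
  have hω : ∀ i, r i = ∑ f ∈ Fi i, c (Sum.inr (Sum.inl f)) - c (Sum.inr (Sum.inr i)) := by
    intro i
    have := LinearMap.congr_fun hb (0, Pi.single i 1)
    simp [col, Z, ω, LinearMap.sum_apply, Pi.single_apply,
      apply_ite (fun l : ((V → ℝ) × (Fin k → ℝ)) →ₗ[ℝ] ℝ => l (0, Pi.single i 1))] at this
    have hFi : Fi i ⊆ F := hF ▸ Finset.subset_biUnion_of_mem Fi (Finset.mem_univ i)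
    have hind : ∀ f, (∑ j, if f ∈ Fi j then if j = i then (1 : ℝ) else 0 else 0) =
        if f ∈ Fi i then 1 else 0 := fun f => by
      rw [Finset.sum_eq_single i (fun j _ hj => by simp [hj]) (by simp)]
      simp
    simp only [hind, mul_ite, mul_one, mul_zero, Finset.sum_ite_mem,
      Finset.inter_eq_right.2 hFi] at this
    linarith
  refine ⟨fun v a => c (Sum.inl ⟨v, a⟩), fun v => c (Sum.inr (Sum.inl v)),
    ⟨fun v hv => ?_, fun v hv => ?_, fun v _ => hc _, fun v _ a _ => hc _⟩, fun i => ?_⟩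
  · simpa [hv] using (hZ v).symm
  · have := hZ v
    simp only [hv, if_true, hsupp v hv] at this
    linarith
  · rw [hω i]
    linarith [hc (Sum.inr (Sum.inr i))]

end MDP

open MDP in
/-- For a cleaned-up MDP with absorbing targets `F_1, …, F_k`, initial distribution `α`
supported on `V ∖ F ≠ ∅`, and `r ∈ (0,1]^k`, the following are equivalent:
(1) some (randomized) memoryless strategy achieves `Pr^σ_α(◇F_i) ≥ r_i` for all `i`;
(2) the multi-objective LP has a feasible solution `y'` with `∑_{v ∈ F_i} y'_v ≥ r_i`
for all `i`; (3) some arbitrary strategy achieves `Pr^σ_α(◇F_i) ≥ r_i` for all `i`. -/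
theorem memoryless_iff_lp_iff_arbitrary
    {V A : Type} [Fintype V] [Fintype A] [Nonempty V] [Nonempty A] [DecidableEq V]
    (M : MDP V A) {k : ℕ} (Fi : Fin k → Finset V) (F : Finset V)
    (hF : F = Finset.univ.biUnion Fi)
    (habs : ∀ v ∈ F, M.Absorbing v)
    (hclean : M.CleanedUp (↑F : Set V))
    (hVF : ∃ v : V, v ∉ F)
    (α : V → ℝ) (hα : IsDist α) (hsupp : ∀ v ∈ F, α v = 0)
    (r : Fin k → ℝ) (hr : ∀ i, 0 < r i ∧ r i ≤ 1) :
    ((∃ σ : M.Strategy, σ.Memoryless ∧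
        ∀ i, r i ≤ M.PrReach σ α (↑(Fi i) : Set V)) ↔
      (∃ (y : V → A → ℝ) (yF : V → ℝ), M.LPFeasible α F y yF ∧
        ∀ i, r i ≤ ∑ v ∈ Fi i, yF v)) ∧
    ((∃ (y : V → A → ℝ) (yF : V → ℝ), M.LPFeasible α F y yF ∧
        ∀ i, r i ≤ ∑ v ∈ Fi i, yF v) ↔
      (∃ σ : M.Strategy, ∀ i, r i ≤ M.PrReach σ α (↑(Fi i) : Set V))) := by
  have hFi : ∀ i, Fi i ⊆ F := fun i => hF ▸ Finset.subset_biUnion_of_mem Fi (Finset.mem_univ i)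
  have hLP : ∀ σ : M.Strategy, (∀ i, r i ≤ M.PrReach σ α (↑(Fi i) : Set V)) →
      ∃ (y : V → A → ℝ) (yF : V → ℝ), M.LPFeasible α F y yF ∧ ∀ i, r i ≤ ∑ v ∈ Fi i, yF v :=
    fun σ hσ => M.exists_feasible_of_le_prReach hF habs hclean hα hsupp σ hσ
  have hmem : (∃ (y : V → A → ℝ) (yF : V → ℝ), M.LPFeasible α F y yF ∧
      ∀ i, r i ≤ ∑ v ∈ Fi i, yF v) → ∃ σ : M.Strategy, σ.Memoryless ∧
        ∀ i, r i ≤ M.PrReach σ α (↑(Fi i) : Set V) := by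
    rintro ⟨y, yF, hy, hyr⟩
    obtain ⟨σ, hσ, hreach⟩ := M.exists_memoryless_of_feasible habs hα hsupp hy
    exact ⟨σ, hσ, fun i => (hyr i).trans_eq (hreach (Fi i) (hFi i)).symm⟩
  refine ⟨⟨fun ⟨σ, _, hσ⟩ => hLP σ hσ, hmem⟩, fun h => ?_, fun ⟨σ, hσ⟩ => hLP σ hσ⟩
  obtain ⟨σ, -, hσ⟩ := hmem h
  exact ⟨σ, hσ⟩
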